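/- arXiv:1201.1447 — 3 statements merged into one kernel-verified Lean document; each statement's English description precedes it below -/
import Mathlib

section
/- Let a < b be real numbers. For every continuously differentiable f : [a,b] → ℂ with derivative f′: (1/sinh(b−a)) · ∫_a^b ( cosh(b−y)·f(y) − sinh(b−y)·f′(y) ) dy = f(a), and (1/sinh(b−a)) · ∫_a^b ( cosh(y−a)·f(y) + sinh(y−a)·f′(y) ) dy = f(b). -/
open MeasureTheory

/-- Integration by parts against a real-valued `C¹` weight `u`. -/
theorem integral_ofReal_deriv_mul_add_ofReal_mul_deriv {a b : ℝ} (hab : a ≤ b) {u u' : ℝ → ℝ}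
    {f f' : ℝ → ℂ} (hu : ∀ x, HasDerivAt u (u' x) x) (hu' : Continuous u')
    (hf : ∀ x ∈ Set.Icc a b, HasDerivWithinAt f (f' x) (Set.Icc a b) x)
    (hf' : ContinuousOn f' (Set.Icc a b)) :
    ∫ y in a..b, ((u' y : ℂ) * f y + (u y : ℂ) * f' y) = u b * f b - u a * f a := by
  rw [← Set.uIcc_of_le hab] at hf hf'
  exact intervalIntegral.integral_deriv_mul_eq_sub_of_hasDerivWithinAt
    (fun x _ => (hu x).ofReal_comp.hasDerivWithinAt) hf
    ((Complex.continuous_ofReal.comp hu').intervalIntegrable a b) hf'.intervalIntegrable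

/-- Lemma 2.3: the kernels `k_a(y) = cosh(b−y)/sinh(b−a)` and `k_b(y) = cosh(y−a)/sinh(b−a)`
reproduce the boundary values `f(a)` and `f(b)` relative to the first-order Sobolev
inner product `⟨g, f⟩ = ∫_a^b (ḡ f + ḡ′ f′)`. -/
theorem stmt2 (a b : ℝ) (hab : a < b) (f f' : ℝ → ℂ)
    (hderiv : ∀ x ∈ Set.Icc a b, HasDerivWithinAt f (f' x) (Set.Icc a b) x)
    (hcont : ContinuousOn f' (Set.Icc a b)) :
    (1 / (Real.sinh (b - a)) : ℂ) *
        (∫ y in a..b, ((Real.cosh (b - y) : ℂ) * f y - (Real.sinh (b - y) : ℂ) * f' y))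
      = f a ∧
    (1 / (Real.sinh (b - a)) : ℂ) *
        (∫ y in a..b, ((Real.cosh (y - a) : ℂ) * f y + (Real.sinh (y - a) : ℂ) * f' y))
      = f b := by
  have hs : (Real.sinh (b - a) : ℂ) ≠ 0 :=
    Complex.ofReal_ne_zero.2 (Real.sinh_pos_iff.2 (sub_pos.2 hab)).ne'
  constructor
  · have hu (x : ℝ) : HasDerivAt (fun y => -Real.sinh (b - y)) (Real.cosh (b - x)) x := by
      simpa using (((hasDerivAt_id x).const_sub b).sinh).fun_neg
    have h := integral_ofReal_deriv_mul_add_ofReal_mul_deriv hab.le hu (by fun_prop) hderiv hcont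
    simp only [Complex.ofReal_neg, neg_mul, ← sub_eq_add_neg, sub_self, Real.sinh_zero,
      Complex.ofReal_zero, zero_mul, neg_zero, zero_sub, neg_neg] at h
    rw [h]
    field_simp
  · have hu (x : ℝ) : HasDerivAt (fun y => Real.sinh (y - a)) (Real.cosh (x - a)) x := by
      simpa using ((hasDerivAt_id x).sub_const a).sinh
    have h := integral_ofReal_deriv_mul_add_ofReal_mul_deriv hab.le hu (by fun_prop) hderiv hcont
    simp only [sub_self, Real.sinh_zero, Complex.ofReal_zero, zero_mul, sub_zero] at h
    rw [h]
    field_simp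
end

section
/- Let 1 < α < β, let 0 < w ≤ 1, and let θ, φ, ψ, λ ∈ ℝ. Complex numbers a, b, c satisfy the two boundary equations w·b·e(φ+λ) − √(1−w²)·c·e(θ−ψ+βλ) = a and √(1−w²)·b·e(ψ+λ) + w·c·e(θ−φ+βλ) = b·e(αλ) if and only if a = b · w⁻¹·e(φ)·e(λ)·(1 − √(1−w²)·e(−ψ+(α−1)λ)) and c = b · w⁻¹·e(φ−θ)·e(−(β−α)λ)·(1 − √(1−w²)·e(ψ−(α−1)λ)). In particular the solution space of the system is one-dimensional, spanned by the triple obtained at b = 1. -/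
open MeasureTheory

/-- `e(x) = exp(2πix)`. -/
noncomputable def eFun (x : ℝ) : ℂ := Complex.exp (2 * (Real.pi : ℂ) * Complex.I * (x : ℂ))

theorem eFun_ne_zero (x : ℝ) : eFun x ≠ 0 := Complex.exp_ne_zero _

theorem eFun_add (x y : ℝ) : eFun (x + y) = eFun x * eFun y := by
  simp only [eFun, Complex.ofReal_add, mul_add, Complex.exp_add]

theorem eFun_sub (x y : ℝ) : eFun (x - y) = eFun x / eFun y := by
  rw [eq_div_iff (eFun_ne_zero y), ← eFun_add, sub_add_cancel]

theorem eFun_neg (x : ℝ) : eFun (-x) = (eFun x)⁻¹ := by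
  refine eq_inv_of_mul_eq_one_left ?_
  rw [← eFun_add, neg_add_cancel]
  simp [eFun]

/-- Lemma 3.2: for `0 < w ≤ 1`, the boundary equations for a candidate generalized
eigenfunction hold if and only if `a` and `c` are given by the explicit formulas
(3.8)–(3.9); in particular each generalized eigenvalue has multiplicity one. -/
theorem stmt5 (α β w θ φ ψ l : ℝ) (hα : 1 < α) (hβ : α < β)
    (hw0 : 0 < w) (hw1 : w ≤ 1) (a b c : ℂ) :
    ((w : ℂ) * b * eFun (φ + l)
        - (Real.sqrt (1 - w ^ 2) : ℂ) * c * eFun (θ - ψ + β * l) = a ∧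
      (Real.sqrt (1 - w ^ 2) : ℂ) * b * eFun (ψ + l)
        + (w : ℂ) * c * eFun (θ - φ + β * l) = b * eFun (α * l))
    ↔
    (a = b * (w : ℂ)⁻¹ * eFun φ * eFun l *
        (1 - (Real.sqrt (1 - w ^ 2) : ℂ) * eFun (-ψ + (α - 1) * l)) ∧
      c = b * (w : ℂ)⁻¹ * eFun (φ - θ) * eFun (-(β - α) * l) *
        (1 - (Real.sqrt (1 - w ^ 2) : ℂ) * eFun (ψ - (α - 1) * l))) := by
  have hw : (w : ℂ) ≠ 0 := by exact_mod_cast hw0.ne'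
  have hs : (Real.sqrt (1 - w ^ 2) : ℂ) ^ 2 = 1 - (w : ℂ) ^ 2 := by
    exact_mod_cast Real.sq_sqrt (by nlinarith : 0 ≤ 1 - w ^ 2)
  have hαl : (α - 1) * l = α * l - l := by ring
  have hβl : -(β - α) * l = α * l - β * l := by ring
  simp only [hαl, hβl, eFun_add, eFun_sub, eFun_neg]
  have hF := eFun_ne_zero φ
  have hL := eFun_ne_zero l
  have hP := eFun_ne_zero ψ
  have hT := eFun_ne_zero θ
  have hA := eFun_ne_zero (α * l)
  have hB := eFun_ne_zero (β * l)
  generalize eFun φ = F at *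
  generalize eFun l = L at *
  generalize eFun ψ = P at *
  generalize eFun θ = T at *
  generalize eFun (α * l) = A at *
  generalize eFun (β * l) = B at *
  generalize (Real.sqrt (1 - w ^ 2) : ℂ) = s at *
  generalize (w : ℂ) = v at *
  have hc : s * b * (P * L) + v * c * (T / F * B) = b * A ↔
      c = b * v⁻¹ * (F / T) * (A / B) * (1 - s * (P / (A / L))) := by
    field_simp
    constructor <;> intro h <;> linear_combination h
  rw [hc]
  refine and_congr_left fun h => ?_
  have ha : v * b * (F * L) - s * c * (T / P * B) =
      b * v⁻¹ * F * L * (1 - s * (P⁻¹ * (A / L))) := by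
    rw [h]
    field_simp
    linear_combination (b * L * P) * hs
  rw [ha, eq_comm]
end

section
/- Fix reals α, β with 1 < α < β, parameters w ∈ (0,1] and θ, φ, ψ ∈ ℝ, and set a(λ) := w⁻¹·e(φ)·e(λ)·(1 − √(1−w²)·e(−ψ+(α−1)λ)) and c(λ) := w⁻¹·e(φ−θ)·e(−(β−α)λ)·(1 − √(1−w²)·e(ψ−(α−1)λ)). For λ ∈ ℝ define ψ_λ on Ω := (−∞,0) ∪ (1,α) ∪ (β,∞) by ψ_λ(x) = a(λ)·e(λx) for x < 0, ψ_λ(x) = e(λx) for 1 < x < α, and ψ_λ(x) = c(λ)·e(λx) for x > β. Then ψ_λ is differentiable on Ω with (2πi)⁻¹·ψ_λ′(x) = λ·ψ_λ(x) for all x ∈ Ω, and its one-sided boundary limits satisfy the boundary condition B·(e(λ), c(λ)·e(βλ))ᵀ = (a(λ), e(αλ))ᵀ, where B = [[w·e(φ), −√(1−w²)·e(θ−ψ)], [√(1−w²)·e(ψ), w·e(θ−φ)]]. -/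
open MeasureTheory

/-- The exterior domain `Ω = (−∞,0) ∪ (1,α) ∪ (β,∞)`. -/
def Oset (α β : ℝ) : Set ℝ := Set.Iio 0 ∪ Set.Ioo 1 α ∪ Set.Ioi β

/-- The coefficient `a(λ)` (eq. (3.8)). -/
noncomputable def acoef (α w θ φ ψ l : ℝ) : ℂ :=
  (w : ℂ)⁻¹ * eFun φ * eFun l *
    (1 - (Real.sqrt (1 - w ^ 2) : ℂ) * eFun (-ψ + (α - 1) * l))

/-- The coefficient `c(λ)` (eq. (3.9)). -/
noncomputable def ccoef (α β w θ φ ψ l : ℝ) : ℂ :=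
  (w : ℂ)⁻¹ * eFun (φ - θ) * eFun (-(β - α) * l) *
    (1 - (Real.sqrt (1 - w ^ 2) : ℂ) * eFun (ψ - (α - 1) * l))

/-- The boundary matrix `B(w,θ,φ,ψ) ∈ U(2)` from (2.21). -/
noncomputable def Bmat (w θ φ ψ : ℝ) : Matrix (Fin 2) (Fin 2) ℂ :=
  ![![(w : ℂ) * eFun φ, -(Real.sqrt (1 - w ^ 2) : ℂ) * eFun (θ - ψ)],
    ![(Real.sqrt (1 - w ^ 2) : ℂ) * eFun ψ, (w : ℂ) * eFun (θ - φ)]]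

/-- The generalized eigenfunction `ψ_λ` on `Ω`. -/
noncomputable def genEig (α β w θ φ ψ l : ℝ) : ℝ → ℂ := fun x =>
  if x < 0 then acoef α w θ φ ψ l * eFun (l * x)
  else if 1 < x ∧ x < α then eFun (l * x)
  else if β < x then ccoef α β w θ φ ψ l * eFun (l * x)
  else 0

theorem hasDerivAt_const_mul_eFun (k : ℂ) (l x : ℝ) :
    HasDerivAt (fun y : ℝ => k * eFun (l * y))
      (2 * (Real.pi : ℂ) * Complex.I * (l : ℂ) * (k * eFun (l * x))) x := by
  have h : HasDerivAt (fun y : ℝ => 2 * (Real.pi : ℂ) * Complex.I * ((l * y : ℝ) : ℂ))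
      (2 * (Real.pi : ℂ) * Complex.I * ((l * 1 : ℝ) : ℂ)) x :=
    (((hasDerivAt_id x).const_mul l).ofReal_comp).const_mul _
  refine (h.cexp.const_mul k).congr_deriv ?_
  simp only [eFun, mul_one]
  ring

/-- A function agreeing with `k · e(l ·)` on an open set solves `f' = 2πi l f` there. -/
theorem hasDerivAt_of_eqOn_const_mul_eFun {f : ℝ → ℂ} {s : Set ℝ} (hs : IsOpen s) {k : ℂ} {l : ℝ}
    (hf : Set.EqOn f (fun y => k * eFun (l * y)) s) {x : ℝ} (hx : x ∈ s) :
    HasDerivAt f (2 * (Real.pi : ℂ) * Complex.I * (l : ℂ) * f x) x := by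
  rw [hf hx]
  exact (hasDerivAt_const_mul_eFun k l x).congr_of_eventuallyEq
    (hf.eventuallyEq_of_mem (hs.mem_nhds hx))

theorem genEig_eqOn_Iio (α β w θ φ ψ l : ℝ) :
    Set.EqOn (genEig α β w θ φ ψ l) (fun y => acoef α w θ φ ψ l * eFun (l * y)) (Set.Iio 0) :=
  fun _ hy => if_pos hy

theorem genEig_eqOn_Ioo (α β w θ φ ψ l : ℝ) :
    Set.EqOn (genEig α β w θ φ ψ l) (fun y => 1 * eFun (l * y)) (Set.Ioo 1 α) := by
  intro y hy
  have h0 : ¬ y < 0 := by linarith [hy.1]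
  have h1 : 1 < y ∧ y < α := hy
  simp only [genEig, if_neg h0, if_pos h1, one_mul]

theorem genEig_eqOn_Ioi {α β : ℝ} (w θ φ ψ l : ℝ) (hα : 1 < α) (hβ : α < β) :
    Set.EqOn (genEig α β w θ φ ψ l) (fun y => ccoef α β w θ φ ψ l * eFun (l * y))
      (Set.Ioi β) := by
  intro y hy
  have h2 : β < y := hy
  have h0 : ¬ y < 0 := by linarith
  have h1 : ¬ (1 < y ∧ y < α) := fun h => by linarith [h.2]
  simp only [genEig, if_neg h0, if_neg h1, if_pos h2]

theorem ofReal_sq_add_sqrt_one_sub_sq {w : ℝ} (hw : w ^ 2 ≤ 1) :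
    (w : ℂ) ^ 2 + (Real.sqrt (1 - w ^ 2) : ℂ) ^ 2 = 1 := by
  rw [← Complex.ofReal_pow (Real.sqrt _), Real.sq_sqrt (by linarith)]
  push_cast
  ring

theorem eFun_mul_ccoef_mul_eFun (α β w θ φ ψ l : ℝ) :
    eFun (θ - φ) * (ccoef α β w θ φ ψ l * eFun (β * l)) =
      (w : ℂ)⁻¹ * (eFun (α * l) - (Real.sqrt (1 - w ^ 2) : ℂ) * (eFun ψ * eFun l)) := by
  have h1 : eFun (θ - φ) * eFun (φ - θ) * eFun (-(β - α) * l) * eFun (β * l) = eFun (α * l) := by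
    simp only [← eFun_add]
    ring_nf
  have h2 : eFun (α * l) * eFun (ψ - (α - 1) * l) = eFun ψ * eFun l := by
    simp only [← eFun_add]
    ring_nf
  simp only [ccoef]
  linear_combination
    (w : ℂ)⁻¹ * (1 - (Real.sqrt (1 - w ^ 2) : ℂ) * eFun (ψ - (α - 1) * l)) * h1
      - (w : ℂ)⁻¹ * (Real.sqrt (1 - w ^ 2) : ℂ) * h2

/-- Theorem 3.13 (generic case `0 < w`, also Theorem 3.11 for `w = 1`): `ψ_λ` satisfies
`(2πi)⁻¹ ψ_λ′ = λ ψ_λ` on `Ω`, and its one-sided boundary limits satisfy the boundary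
condition `B·(e(λ), c(λ)e(βλ))ᵀ = (a(λ), e(αλ))ᵀ`. -/
theorem stmt7 (α β w θ φ ψ l : ℝ) (hα : 1 < α) (hβ : α < β)
    (hw0 : 0 < w) (hw1 : w ≤ 1) :
    (∀ x ∈ Oset α β,
      HasDerivAt (genEig α β w θ φ ψ l)
        (2 * (Real.pi : ℂ) * Complex.I * (l : ℂ) * genEig α β w θ φ ψ l x) x) ∧
    (Bmat w θ φ ψ).mulVec ![eFun l, ccoef α β w θ φ ψ l * eFun (β * l)]
      = ![acoef α w θ φ ψ l, eFun (α * l)] := by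
  refine ⟨?_, ?_⟩
  · rintro x ((hx | hx) | hx)
    · exact hasDerivAt_of_eqOn_const_mul_eFun isOpen_Iio (genEig_eqOn_Iio α β w θ φ ψ l) hx
    · exact hasDerivAt_of_eqOn_const_mul_eFun isOpen_Ioo (genEig_eqOn_Ioo α β w θ φ ψ l) hx
    · exact hasDerivAt_of_eqOn_const_mul_eFun isOpen_Ioi (genEig_eqOn_Ioi w θ φ ψ l hα hβ) hx
  · have hw : (w : ℂ) ≠ 0 := Complex.ofReal_ne_zero.mpr hw0.ne'
    have hinv : (w : ℂ) * (w : ℂ)⁻¹ = 1 := mul_inv_cancel₀ hw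
    have hs := ofReal_sq_add_sqrt_one_sub_sq (w := w) (by nlinarith)
    have hc := eFun_mul_ccoef_mul_eFun α β w θ φ ψ l
    have h1 : eFun (θ - ψ) = eFun (φ - ψ) * eFun (θ - φ) := by
      rw [← eFun_add]
      ring_nf
    have h2 : eFun (φ - ψ) * eFun ψ = eFun φ := by
      rw [← eFun_add]
      ring_nf
    have h3 : eFun φ * eFun l * eFun (-ψ + (α - 1) * l) = eFun (φ - ψ) * eFun (α * l) := by
      simp only [← eFun_add]
      ring_nf
    ext i
    fin_cases i
    · simp [Bmat, Matrix.mulVec, dotProduct, Fin.sum_univ_two]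
      rw [h1, acoef]
      generalize (Real.sqrt (1 - w ^ 2) : ℂ) = s at *
      linear_combination (-s * eFun (φ - ψ)) * hc + (w : ℂ)⁻¹ * s ^ 2 * eFun l * h2
        + (w : ℂ)⁻¹ * s * h3 + (w : ℂ)⁻¹ * eFun φ * eFun l * hs
        - (w : ℂ) * eFun φ * eFun l * hinv
    · simp [Bmat, Matrix.mulVec, dotProduct, Fin.sum_univ_two]
      linear_combination (w : ℂ) * hc + (eFun (α * l)
        - (Real.sqrt (1 - w ^ 2) : ℂ) * (eFun ψ * eFun l)) * hinv
end
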